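/- arXiv:2310.04064 — 9 statements merged into one kernel-verified Lean document; each statement's English description precedes it below -/
import Mathlib

section
/- Let ε_D ∈ (0,0.1), B > 1, and let V ∈ ℝ^{n²×d} satisfy ‖V‖_∞ ≤ B². Let Ã ∈ ℝ^{n×n²} have positive entries, let D̃ := diag(Ã 𝟏_{n²}), and let D ∈ ℝ^{n×n} be a diagonal matrix with positive diagonal entries such that |D̃_{i,i} − D_{i,i}| ≤ ε_D · D_{i,i} for all i ∈ [n]. Then ‖D̃^{-1} Ã V − D^{-1} Ã V‖_∞ ≤ ε_D · B². -/
open BigOperators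

/-- First half of the error propagation: with `D̃ := diag(A' 𝟏_{n²})` for a positive matrix
`A'`, and `D` a positive diagonal matrix with `|D̃_{i,i} − D_{i,i}| ≤ ε_D·D_{i,i}`, and
`‖V‖_∞ ≤ B²`, we get `‖D̃⁻¹ A' V − D⁻¹ A' V‖_∞ ≤ ε_D·B²`. -/
theorem error_from_D_to_attention
    (n d : ℕ) (εD B : ℝ)
    (hεD : 0 < εD) (hεD' : εD < 0.1) (hB : 1 < B)
    (V : Matrix (Fin (n ^ 2)) (Fin d) ℝ) (hV : ∀ l j, |V l j| ≤ B ^ 2)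
    (A' : Matrix (Fin n) (Fin (n ^ 2)) ℝ)
    (hA'pos : ∀ i l, 0 < A' i l)
    (D : Fin n → ℝ) (hDpos : ∀ i, 0 < D i)
    (hDapprox : ∀ i, |(∑ l, A' i l) - D i| ≤ εD * D i) :
    ∀ (i : Fin n) (j : Fin d),
      |(∑ l, (∑ l', A' i l')⁻¹ * A' i l * V l j) - (∑ l, (D i)⁻¹ * A' i l * V l j)|
        ≤ εD * B ^ 2 := by
  intro i j
  have hn : 0 < n ^ 2 := pow_pos i.pos 2
  have hS : 0 < ∑ l, A' i l :=
    Finset.sum_pos (fun l _ => hA'pos i l) ⟨⟨0, hn⟩, Finset.mem_univ _⟩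
  have hT : |∑ l, A' i l * V l j| ≤ (∑ l, A' i l) * B ^ 2 := by
    rw [Finset.sum_mul]
    refine (Finset.abs_sum_le_sum_abs _ _).trans (Finset.sum_le_sum fun l _ => ?_)
    rw [abs_mul, abs_of_pos (hA'pos i l)]
    exact mul_le_mul_of_nonneg_left (hV l j) (hA'pos i l).le
  have hD := hDpos i
  have happrox := hDapprox i
  simp only [mul_assoc, ← Finset.mul_sum]
  rw [← sub_mul, abs_mul]
  generalize ∑ l, A' i l = S at *
  have hinv : |S⁻¹ - (D i)⁻¹| * S ≤ εD := by
    have h : |S⁻¹ - (D i)⁻¹| * S = |S - D i| / D i := by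
      rw [inv_sub_inv hS.ne' hD.ne', abs_div, abs_mul, abs_of_pos hS, abs_of_pos hD,
        abs_sub_comm]
      field_simp
    rw [h]
    exact (div_le_iff₀ hD).2 happrox
  calc _ ≤ |S⁻¹ - (D i)⁻¹| * (S * B ^ 2) := mul_le_mul_of_nonneg_left hT (abs_nonneg _)
    _ = |S⁻¹ - (D i)⁻¹| * S * B ^ 2 := by ring
    _ ≤ εD * B ^ 2 := mul_le_mul_of_nonneg_right hinv (sq_nonneg B)
end

section
/- Let ε ∈ (0,0.1), B > 1, and let V ∈ ℝ^{n²×d} satisfy ‖V‖_∞ ≤ B². Let A ∈ ℝ^{n×n²} have positive entries and let Ã ∈ ℝ^{n×n²} satisfy |Ã_{i,l} − A_{i,l}| ≤ ε · A_{i,l} for all (i,l) ∈ [n]×[n²]. Define D := diag(A 𝟏_{n²}) and D̃ := diag(Ã 𝟏_{n²}). Then ‖D̃^{-1} Ã V − D^{-1} A V‖_∞ ≤ 2ε · B². -/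
open BigOperators

/-- If the weights `b` approximate the positive weights `a` within relative error `ε ≤ 1 / 2`,
then the normalized weights are within `2 * ε` in the `ℓ¹` distance. -/
theorem sum_abs_normalized_sub_le {ι : Type*} [Fintype ι] [Nonempty ι] {ε : ℝ}
    (hε : 0 < ε) (hε' : ε ≤ 1 / 2) {a b : ι → ℝ} (ha : ∀ l, 0 < a l)
    (hab : ∀ l, |b l - a l| ≤ ε * a l) :
    ∑ l, |(∑ l', b l')⁻¹ * b l - (∑ l', a l')⁻¹ * a l| ≤ 2 * ε := by
  set s := ∑ l, a l with hs
  set t := ∑ l, b l with ht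
  have s_pos : 0 < s := Finset.sum_pos (fun l _ => ha l) Finset.univ_nonempty
  have hts : |t - s| ≤ ε * s := by
    rw [ht, hs, ← Finset.sum_sub_distrib, Finset.mul_sum]
    exact (Finset.abs_sum_le_sum_abs _ _).trans (Finset.sum_le_sum fun l _ => hab l)
  have hts' := abs_le.mp hts
  have hst : s ≤ 2 * t := by nlinarith
  have t_pos : 0 < t := by linarith
  obtain ⟨k, hk⟩ : ∃ k, t - s = k * (ε * s) := ⟨(t - s) / (ε * s), by field_simp⟩
  have εs_pos : 0 < ε * s := mul_pos hε s_pos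
  have hk₁ : k ≤ 1 := by nlinarith
  have hk₂ : -1 ≤ k := by nlinarith
  -- The convex function `x ↦ |x - k * ε|` lies below its chord on `[-ε, ε]`.
  have chord (l : ι) : |t⁻¹ * b l - s⁻¹ * a l| ≤ t⁻¹ * (ε * a l - k * (b l - a l)) := by
    have h : t⁻¹ * b l - s⁻¹ * a l = t⁻¹ * ((b l - a l) - k * (ε * a l)) := by
      field_simp
      linear_combination (-a l) * hk
    rw [h, abs_mul, abs_of_pos (inv_pos.mpr t_pos)]
    refine mul_le_mul_of_nonneg_left ?_ (inv_pos.mpr t_pos).le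
    have hl := abs_le.mp (hab l)
    rw [abs_le]
    constructor <;> nlinarith
  calc ∑ l, |t⁻¹ * b l - s⁻¹ * a l|
      ≤ ∑ l, t⁻¹ * (ε * a l - k * (b l - a l)) := Finset.sum_le_sum fun l _ => chord l
    _ = t⁻¹ * (ε * s - k * (t - s)) := by
      rw [← Finset.mul_sum, Finset.sum_sub_distrib, ← Finset.mul_sum, ← Finset.mul_sum,
        Finset.sum_sub_distrib]
    _ ≤ 2 * ε := by
      rw [inv_mul_le_iff₀ t_pos, hk]
      nlinarith [mul_nonneg (sq_nonneg k) εs_pos.le]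

/-- Combined error propagation: with `D := diag(A 𝟏_{n²})` and `D̃ := diag(A' 𝟏_{n²})`,
for a positive matrix `A` and an entrywise relative `ε`-approximation `A'`, and `‖V‖_∞ ≤ B²`,
we get `‖D̃⁻¹ A' V − D⁻¹ A V‖_∞ ≤ 2ε·B²`. -/
theorem error_to_attention_combined
    (n d : ℕ) (ε B : ℝ)
    (hε : 0 < ε) (hε' : ε < 0.1) (hB : 1 < B)
    (V : Matrix (Fin (n ^ 2)) (Fin d) ℝ) (hV : ∀ l j, |V l j| ≤ B ^ 2)
    (A A' : Matrix (Fin n) (Fin (n ^ 2)) ℝ)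
    (hApos : ∀ i l, 0 < A i l)
    (hAapprox : ∀ i l, |A' i l - A i l| ≤ ε * A i l) :
    ∀ (i : Fin n) (j : Fin d),
      |(∑ l, (∑ l', A' i l')⁻¹ * A' i l * V l j) - (∑ l, (∑ l', A i l')⁻¹ * A i l * V l j)|
        ≤ 2 * ε * B ^ 2 := by
  intro i j
  have : Nonempty (Fin (n ^ 2)) := ⟨⟨0, pow_pos i.pos 2⟩⟩
  have key := sum_abs_normalized_sub_le hε (by norm_num at hε'; linarith) (hApos i) (hAapprox i)
  rw [← Finset.sum_sub_distrib]
  calc |∑ l, ((∑ l', A' i l')⁻¹ * A' i l * V l j - (∑ l', A i l')⁻¹ * A i l * V l j)|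
      ≤ ∑ l, |(∑ l', A' i l')⁻¹ * A' i l * V l j - (∑ l', A i l')⁻¹ * A i l * V l j| :=
        Finset.abs_sum_le_sum_abs _ _
    _ ≤ ∑ l, |(∑ l', A' i l')⁻¹ * A' i l - (∑ l', A i l')⁻¹ * A i l| * B ^ 2 := by
      refine Finset.sum_le_sum fun l _ => ?_
      rw [← sub_mul, abs_mul]
      exact mul_le_mul_of_nonneg_left (hV l j) (abs_nonneg _)
    _ ≤ 2 * ε * B ^ 2 := by
      rw [← Finset.sum_mul]
      exact mul_le_mul_of_nonneg_right key (sq_nonneg B)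
end

section
/- There is an absolute constant c > 0 such that for every B > 1 and every ε ∈ (0,0.1), there exists a real polynomial P of a single variable of degree at most c · max{ log(1/ε) / log(2 + log(1/ε)/B), B } such that for all x ∈ [−B, B], (1−ε)·exp(x) < P(x) < (1+ε)·exp(x). -/
open Real

/-- Taylor remainder of the real exponential, for orders at least `2 * |x|`. -/
theorem abs_exp_sub_taylor_le {x : ℝ} {n : ℕ} (hx : |x| / (n + 1) ≤ 1 / 2) :
    |Real.exp x - ∑ m ∈ Finset.range n, x ^ m / m.factorial|
      ≤ |x| ^ n / n.factorial * 2 := by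
  have h := Complex.exp_bound' (x := (x : ℂ)) (n := n) (by simpa using hx)
  rw [Complex.norm_real, Real.norm_eq_abs] at h
  rw [← Real.norm_eq_abs, ← Complex.norm_real]
  push_cast
  exact h

/-- The bound `n ! ≥ (n / e) ^ n`, as an upper bound on `B ^ n / n !`. -/
theorem pow_div_factorial_le_exp_mul_div_pow {B : ℝ} {n : ℕ} (hB : 0 ≤ B) (hn : 0 < n) :
    B ^ n / n.factorial ≤ (Real.exp 1 * B / n) ^ n := by
  have hn' : (0 : ℝ) < n := by exact_mod_cast hn
  have h := Real.pow_div_factorial_le_exp (n : ℝ) hn'.le n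
  have e : B ^ n / n.factorial = (B / n) ^ n * ((n : ℝ) ^ n / n.factorial) := by
    rw [div_pow]
    field_simp
  have e' : (Real.exp 1 * B / n) ^ n = (B / n) ^ n * Real.exp n := by
    rw [← Real.exp_one_pow, mul_div_assoc, mul_pow, mul_comm]
  rw [e, e']
  gcongr

/-- The maximum of `L / log (2 + L / B)` and `B` dominates `B * √(2 + L / B)`. -/
theorem mul_exp_half_log_le_max {B L : ℝ} (hB : 0 < B) (hL : 0 < L) :
    B * Real.exp (Real.log (2 + L / B) / 2)
      ≤ 4 * max (L / Real.log (2 + L / B)) B := by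
  have hr : 0 < L / B := div_pos hL hB
  have hLr : L = L / B * B := by field_simp
  set r := L / B
  have hl : 0 < Real.log (2 + r) := Real.log_pos (by linarith)
  have hE : Real.exp (Real.log (2 + r) / 2) ^ 2 = 2 + r := by
    rw [← Real.exp_nat_mul, Nat.cast_ofNat, mul_div_cancel₀ _ two_ne_zero,
      Real.exp_log (by linarith)]
  have hlE := Real.add_one_le_exp (Real.log (2 + r) / 2)
  have hE0 := Real.exp_pos (Real.log (2 + r) / 2)
  set E := Real.exp (Real.log (2 + r) / 2)
  set l := Real.log (2 + r)
  rcases le_total r 2 with h | h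
  · have : E ≤ 2 := by nlinarith
    nlinarith [le_max_right (L / l) B]
  · have h1 : B * E / 4 ≤ L / l := by
      rw [le_div_iff₀ hl, hLr]
      have h2 : E * l ≤ E * (2 * E) := by gcongr; linarith
      nlinarith
    linarith [le_max_left (L / l) B]

/-- Polynomial approximation of the exponential on `[−B,B]`: there is an absolute constant
`c > 0` such that for every `B > 1` and `ε ∈ (0,0.1)` there is a real polynomial `P` of degree
at most `c·max{log(1/ε)/log(2 + log(1/ε)/B), B}` with
`(1−ε)·exp(x) < P(x) < (1+ε)·exp(x)` for all `x ∈ [−B,B]`. -/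
theorem poly_approx_exp :
    ∃ c : ℝ, 0 < c ∧
      ∀ B ε : ℝ, 1 < B → 0 < ε → ε < 0.1 →
        ∃ P : Polynomial ℝ,
          (P.natDegree : ℝ)
            ≤ c * max (Real.log (1 / ε) / Real.log (2 + Real.log (1 / ε) / B)) B ∧
          ∀ x : ℝ, x ∈ Set.Icc (-B) B →
            (1 - ε) * Real.exp x < P.eval x ∧ P.eval x < (1 + ε) * Real.exp x := by
  refine ⟨33, by norm_num, fun B ε hB hε hε1 => ?_⟩
  have hB0 : 0 < B := by linarith
  have hL : 0 < Real.log (1 / ε) :=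
    Real.log_pos (by rw [lt_div_iff₀ hε]; norm_num at hε1 ⊢; linarith)
  have hεL : ε = Real.exp (-Real.log (1 / ε)) := by
    rw [one_div, Real.log_inv, neg_neg, Real.exp_log hε]
  have key := mul_exp_half_log_le_max hB0 hL
  set L := Real.log (1 / ε)
  have hl : 0 < Real.log (2 + L / B) :=
    Real.log_pos (by linarith [div_pos hL hB0])
  set l := Real.log (2 + L / B)
  have hMB := le_max_right (L / l) B
  have hML : L ≤ max (L / l) B * l := by
    rw [← div_le_iff₀ hl]
    exact le_max_left _ _
  set M := max (L / l) B
  have hn1 := Nat.le_ceil (32 * M)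
  have hn2 := Nat.ceil_lt_add_one (show 0 ≤ 32 * M by linarith)
  set n := ⌈32 * M⌉₊
  have hn0 : (0 : ℝ) < n := by linarith
  have hbase : Real.exp 1 * B / n ≤ Real.exp (-(1 + l / 2)) := by
    rw [div_le_iff₀ hn0, Real.exp_neg, inv_mul_eq_div, le_div_iff₀ (Real.exp_pos _),
      Real.exp_add]
    have he : Real.exp 1 * Real.exp 1 ≤ 8 := by
      nlinarith [Real.exp_one_lt_d9, Real.exp_pos 1]
    calc Real.exp 1 * B * (Real.exp 1 * Real.exp (l / 2))
        = Real.exp 1 * Real.exp 1 * (B * Real.exp (l / 2)) := by ring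
      _ ≤ 8 * (B * Real.exp (l / 2)) := by gcongr
      _ ≤ n := by linarith
  have herr : B ^ n / n.factorial * 2 < ε * Real.exp (-B) := by
    have hexp : (n : ℝ) * -(1 + l / 2) ≤ -(32 * B + 16 * L) := by
      nlinarith [mul_le_mul_of_nonneg_right hn1 hl.le]
    calc B ^ n / n.factorial * 2
        ≤ Real.exp (-(1 + l / 2)) ^ n * Real.exp 1 := by
          gcongr
          · exact (pow_div_factorial_le_exp_mul_div_pow hB0.le (by exact_mod_cast hn0)).trans
              (by gcongr)
          · linarith [Real.add_one_le_exp 1]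
      _ = Real.exp (n * -(1 + l / 2) + 1) := by rw [← Real.exp_nat_mul, ← Real.exp_add]
      _ < Real.exp (-L + -B) := Real.exp_lt_exp.mpr (by linarith)
      _ = ε * Real.exp (-B) := by rw [Real.exp_add, ← hεL]
  refine ⟨∑ m ∈ Finset.range n, Polynomial.monomial m (1 / (m.factorial : ℝ)), ?_, ?_⟩
  · have hdeg : (∑ m ∈ Finset.range n,
        Polynomial.monomial m (1 / (m.factorial : ℝ))).natDegree ≤ n :=
      Polynomial.natDegree_sum_le_of_forall_le _ _ fun m hm =>
        (Polynomial.natDegree_monomial_le _).trans (Finset.mem_range.mp hm).le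
    have : ((∑ m ∈ Finset.range n,
        Polynomial.monomial m (1 / (m.factorial : ℝ))).natDegree : ℝ) ≤ n := by
      exact_mod_cast hdeg
    linarith
  · intro x hx
    have hxB : |x| ≤ B := abs_le.mpr hx
    have heval : (∑ m ∈ Finset.range n,
        Polynomial.monomial m (1 / (m.factorial : ℝ))).eval x
          = ∑ m ∈ Finset.range n, x ^ m / m.factorial := by
      simp [Polynomial.eval_finsetSum, div_eq_inv_mul]
    have ht := abs_exp_sub_taylor_le (x := x) (n := n)
      (by rw [div_le_iff₀ (by linarith)]; linarith)
    have hlt : |Real.exp x - ∑ m ∈ Finset.range n, x ^ m / m.factorial|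
        < ε * Real.exp x :=
      calc _ ≤ |x| ^ n / n.factorial * 2 := ht
        _ ≤ B ^ n / n.factorial * 2 := by gcongr
        _ < ε * Real.exp (-B) := herr
        _ ≤ ε * Real.exp x := by gcongr; exact hx.1
    rw [heval]
    obtain ⟨h1, h2⟩ := abs_lt.mp hlt
    constructor <;> linarith
end

section
/- Let X, Y, Z ∈ ℝ^{n×d}, let M := X ⊙ Y ⊙ Z ∈ ℝ^{n×n×n}, let P be a real polynomial of a single variable of degree at most g, and set r := C(3(g+d), 3g) (binomial coefficient). Then there exist matrices U₁, U₂, U₃ ∈ ℝ^{n×r} such that for all i, j, l ∈ [n], P(M_{i,j,l}) = Σ_{t=1}^r (U₁)_{i,t} (U₂)_{j,t} (U₃)_{l,t}; that is, the entrywise application of P to M equals U₁ ⊙ U₂ ⊙ U₃ (with the ⊙ construction applied with inner dimension r). -/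
open BigOperators

theorem sum_range_multichoose (d g : ℕ) :
    ∑ k ∈ Finset.range (g + 1), Nat.multichoose d k = Nat.multichoose (d + 1) g := by
  induction g with
  | zero => simp
  | succ g ih => rw [Finset.sum_range_succ, ih, Nat.multichoose_succ_succ, add_comm]

theorem choose_le_choose_add_add {a b i j : ℕ} (hj : j ≤ b) :
    Nat.choose a i ≤ Nat.choose (a + b) (i + j) := by
  rw [Nat.add_choose_eq]
  calc Nat.choose a i ≤ Nat.choose a i * Nat.choose b j :=
        Nat.le_mul_of_pos_right _ (Nat.choose_pos hj)
    _ ≤ _ := Finset.single_le_sum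
        (f := fun p : ℕ × ℕ => Nat.choose a p.1 * Nat.choose b p.2)
        (fun _ _ => Nat.zero_le _) (a := (i, j)) (by simp)

/-- A tensor decomposition indexed by a finite type can be padded with zeros to one indexed by
`Fin r`, for every `r` at least the size of the index type. -/
theorem exists_fin_decomposition_of_card_le {ι κ R : Type*} [Fintype ι] [CommSemiring R] {r : ℕ}
    (hr : Fintype.card ι ≤ r) (A B C : κ → ι → R) :
    ∃ A' B' C' : Matrix κ (Fin r) R, ∀ i j l,
      ∑ s, A i s * B j s * C l s = ∑ t, A' i t * B' j t * C' l t := by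
  obtain ⟨e⟩ : Nonempty (ι ↪ Fin r) :=
    Function.Embedding.nonempty_of_card_le (by simpa using hr)
  refine ⟨fun i => Function.extend e (A i) 0, fun j => Function.extend e (B j) 0,
    fun l => Function.extend e (C l) 0, fun i j l => ?_⟩
  refine Fintype.sum_of_injective e e.injective _ _ (fun t ht => ?_) (fun s => ?_)
  · simp [Function.extend_apply' _ _ _ ht]
  · simp only [e.injective.extend_apply]

/-- Low-rank decomposition of a polynomial applied entrywise to the tensor
`M = X ⊙ Y ⊙ Z`: if `P` has degree at most `g` and `r = C(3(g+d), 3g)`, then there are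
matrices `U₁, U₂, U₃ ∈ ℝ^{n×r}` with `P(M) = U₁ ⊙ U₂ ⊙ U₃`. -/
theorem poly_of_tensor_low_rank
    (n d g : ℕ) (X Y Z : Matrix (Fin n) (Fin d) ℝ)
    (P : Polynomial ℝ) (hP : P.natDegree ≤ g) :
    ∃ U₁ U₂ U₃ : Matrix (Fin n) (Fin (Nat.choose (3 * (g + d)) (3 * g))) ℝ,
      ∀ i j l : Fin n,
        P.eval (∑ ℓ, X i ℓ * Y j ℓ * Z l ℓ) = ∑ t, U₁ i t * U₂ j t * U₃ l t := by
  have hcard : Fintype.card (Σ k : Fin (g + 1), Sym (Fin d) k) ≤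
      Nat.choose (3 * (g + d)) (3 * g) := by
    have hsum : Fintype.card (Σ k : Fin (g + 1), Sym (Fin d) k) = Nat.choose (g + d) g := by
      simp only [Fintype.card_sigma, Sym.card_sym_eq_multichoose, Fintype.card_fin]
      rw [Fin.sum_univ_eq_sum_range (fun k => Nat.multichoose d k), sum_range_multichoose,
        Nat.multichoose_eq]
      congr 1
      omega
    rw [hsum, show 3 * (g + d) = (g + d) + 2 * (g + d) by ring, show 3 * g = g + 2 * g by ring]
    exact choose_le_choose_add_add (by omega)
  obtain ⟨U₁, U₂, U₃, hU⟩ := exists_fin_decomposition_of_card_le hcard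
    (fun i s => P.coeff s.1 * (s.2 : Multiset (Fin d)).countPerms *
      ((s.2 : Multiset (Fin d)).map (X i)).prod)
    (fun j s => ((s.2 : Multiset (Fin d)).map (Y j)).prod)
    (fun l s => ((s.2 : Multiset (Fin d)).map (Z l)).prod)
  refine ⟨U₁, U₂, U₃, fun i j l => ?_⟩
  rw [← hU, Polynomial.eval_eq_sum_range' (Nat.lt_succ_of_le hP), Fintype.sum_sigma,
    ← Fin.sum_univ_eq_sum_range (fun k => P.coeff k * (∑ ℓ, X i ℓ * Y j ℓ * Z l ℓ) ^ k)]
  refine Finset.sum_congr rfl fun k _ => ?_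
  rw [Finset.sum_pow, Finset.sym_univ, Finset.mul_sum]
  refine Finset.sum_congr rfl fun s _ => ?_
  simp only [Multiset.prod_map_mul, Sym.val_eq_coe]
  ring
end

section
/- Let P be a real polynomial of a single variable of degree at most g, let d be a positive integer, and set r := C(3d + 3g, 3g) (binomial coefficient). Then there exist functions φ₁, φ₂, φ₃ : ℝ^d → ℝ^r such that for all u, v, w ∈ ℝ^d, P(Σ_{ℓ=1}^d u_ℓ v_ℓ w_ℓ) = Σ_{t=1}^r φ₁(u)_t · φ₂(v)_t · φ₃(w)_t. -/
/-- A trilinear expansion indexed by a finite type with at most `r` elements can be reindexed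
by `Fin r`, padding with zeros. -/
theorem exists_fin_trilinear_of_card_le {ι α β γ R : Type*} [Fintype ι] [Semiring R] {r : ℕ}
    (h : Fintype.card ι ≤ r) (a : α → ι → R) (b : β → ι → R) (c : γ → ι → R) :
    ∃ (φ₁ : α → Fin r → R) (φ₂ : β → Fin r → R) (φ₃ : γ → Fin r → R),
      ∀ u v w, ∑ i, a u i * b v i * c w i = ∑ t, φ₁ u t * φ₂ v t * φ₃ w t := by
  obtain ⟨e⟩ : Nonempty (ι ↪ Fin r) := Function.Embedding.nonempty_of_card_le (by simpa using h)
  refine ⟨fun u => Function.extend e (a u) 0, fun v => Function.extend e (b v) 0,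
    fun w => Function.extend e (c w) 0, fun u v w => ?_⟩
  refine Fintype.sum_of_injective e e.injective _ _ (fun t ht => ?_) (fun i => ?_)
  · have ht' : ¬ ∃ i, e i = t := ht
    simp [Function.extend_apply' _ _ _ ht']
  · simp [e.injective.extend_apply]

/-- The number of monomials of degree at most `g` in `d` variables. -/
theorem card_sigma_sym (d g : ℕ) :
    Fintype.card (Σ n : Fin (g + 1), Sym (Fin d) n) = (d + g).choose g := by
  rw [Fintype.card_sigma]
  simp only [Sym.card_sym_eq_multichoose, Fintype.card_fin]
  rw [Fin.sum_univ_eq_sum_range (fun n => d.multichoose n) (g + 1), Nat.sum_range_multichoose,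
    add_comm g d, Nat.choose_symm_add]

theorem choose_add_le_choose_mul_add_mul (d g k : ℕ) (hk : 0 < k) :
    (d + g).choose g ≤ (k * d + k * g).choose (k * g) := by
  have hd : d ≤ k * d := Nat.le_mul_of_pos_left d hk
  have hg : g ≤ k * g := Nat.le_mul_of_pos_left g hk
  calc (d + g).choose g ≤ (k * d + g).choose g := Nat.choose_le_choose _ (by omega)
    _ = (k * d + g).choose (k * d) := Nat.choose_symm_add.symm
    _ ≤ (k * d + k * g).choose (k * d) := Nat.choose_le_choose _ (by omega)
    _ = (k * d + k * g).choose (k * g) := Nat.choose_symm_add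

/-- Multinomial expansion of a polynomial evaluated at a sum. -/
theorem Polynomial.eval_sum_eq_sum_sym {R ι : Type*} [CommSemiring R] [Fintype ι] [DecidableEq ι]
    {P : Polynomial R} {g : ℕ} (hP : P.natDegree ≤ g) (x : ι → R) :
    P.eval (∑ i, x i) = ∑ s : Σ n : Fin (g + 1), Sym ι n,
      P.coeff s.1 * (s.2 : Multiset ι).countPerms * ((s.2 : Multiset ι).map x).prod := by
  rw [Polynomial.eval_eq_sum_range' (Nat.lt_succ_of_le hP), Fintype.sum_sigma,
    ← Fin.sum_univ_eq_sum_range (fun n => P.coeff n * (∑ i, x i) ^ n) (g + 1)]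
  refine Finset.sum_congr rfl fun n _ => ?_
  rw [Finset.sum_pow, Finset.mul_sum]
  simp [mul_assoc]

/-- Feature-map decomposition of a polynomial of the 3-wise inner product: if `P` has degree
at most `g` and `r = C(3d+3g, 3g)`, then there are maps `φ₁, φ₂, φ₃ : ℝ^d → ℝ^r` with
`P(⟨u,v,w⟩) = Σ_t φ₁(u)_t · φ₂(v)_t · φ₃(w)_t` for all `u,v,w ∈ ℝ^d`. -/
theorem poly_of_threewise_inner_product_feature_maps
    (d g : ℕ) (hd : 0 < d) (P : Polynomial ℝ) (hP : P.natDegree ≤ g) :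
    ∃ φ₁ φ₂ φ₃ : (Fin d → ℝ) → (Fin (Nat.choose (3 * d + 3 * g) (3 * g)) → ℝ),
      ∀ u v w : Fin d → ℝ,
        P.eval (∑ ℓ, u ℓ * v ℓ * w ℓ) = ∑ t, φ₁ u t * φ₂ v t * φ₃ w t := by
  have hcard : Fintype.card (Σ n : Fin (g + 1), Sym (Fin d) n) ≤ (3 * d + 3 * g).choose (3 * g) :=
    (card_sigma_sym d g).trans_le (choose_add_le_choose_mul_add_mul d g 3 three_pos)
  obtain ⟨φ₁, φ₂, φ₃, h⟩ := exists_fin_trilinear_of_card_le hcard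
    (fun (u : Fin d → ℝ) s => P.coeff s.1 * (s.2 : Multiset (Fin d)).countPerms *
      ((s.2 : Multiset (Fin d)).map u).prod)
    (fun (v : Fin d → ℝ) s => ((s.2 : Multiset (Fin d)).map v).prod)
    (fun (w : Fin d → ℝ) s => ((s.2 : Multiset (Fin d)).map w).prod)
  refine ⟨φ₁, φ₂, φ₃, fun u v w => ?_⟩
  rw [← h, Polynomial.eval_sum_eq_sum_sym hP]
  simp only [Multiset.prod_map_mul, mul_assoc]
end

section
/- There is an absolute constant c > 0 such that the following holds. Let B > 1, ε ∈ (0,0.1), and let Q, K₁, K₂ ∈ ℝ^{n×d} satisfy ‖Q‖_∞ ≤ B, ‖K₁‖_∞ ≤ B, ‖K₂‖_∞ ≤ B. Define the tensor A ∈ ℝ^{n×n×n} by A_{i,j,l} = exp((Q ⊙ K₁ ⊙ K₂)_{i,j,l} / d). Then there exist a natural number g ≤ c · max{ log(1/ε) / log(2 + log(1/ε)/B³), B³ }, a natural number r ≤ C(3(g+d), 3g), and matrices U₁, U₂, U₃ ∈ ℝ^{n×r} such that the tensor Ã defined by Ã_{i,j,l} = Σ_{t=1}^r (U₁)_{i,t}(U₂)_{j,t}(U₃)_{l,t}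 satisfies |Ã_{i,j,l} − A_{i,j,l}| ≤ ε · A_{i,j,l} for all i, j, l ∈ [n]. -/
open BigOperators Real

lemma sum_range_succ_multichoose (d g : ℕ) :
    ∑ k ∈ Finset.range (g + 1), d.multichoose k = (d + 1).multichoose g := by
  induction g with
  | zero => simp
  | succ g ih => rw [Finset.sum_range_succ, ih, Nat.multichoose_succ_succ, add_comm]

lemma card_sigma_sym_le (d g : ℕ) :
    Fintype.card (Σ k : Fin g, Sym (Fin d) k) ≤ (g + d).choose g := by
  rw [Fintype.card_sigma]
  simp only [Sym.card_sym_eq_multichoose, Fintype.card_fin]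
  rw [Fin.sum_univ_eq_sum_range (fun k => d.multichoose k) g]
  calc ∑ k ∈ Finset.range g, d.multichoose k
      ≤ ∑ k ∈ Finset.range (g + 1), d.multichoose k :=
        Finset.sum_le_sum_of_subset (Finset.range_subset_range.2 g.le_succ)
    _ = (g + d).choose g := by
        rw [sum_range_succ_multichoose, Nat.multichoose_eq]
        congr 1
        omega

lemma choose_add_left_mono {a b a' b' : ℕ} (ha : a ≤ a') (hb : b ≤ b') :
    (a + b).choose a ≤ (a' + b').choose a' := by
  calc (a + b).choose a = (a + b).choose b := Nat.choose_symm_add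
    _ ≤ (a' + b).choose b := Nat.choose_le_choose b (by omega)
    _ = (a' + b).choose a' := Nat.choose_symm_add.symm
    _ ≤ (a' + b').choose a' := Nat.choose_le_choose a' (by omega)

/-- A polynomial of degree less than `g` in the entries of `X ⊙ Y ⊙ Z` is a tensor of rank at most
the number of monomials of degree less than `g` in `d` variables. -/
lemma exists_tensor_factorization_polynomial {n d : ℕ} (g : ℕ) (a : ℕ → ℝ)
    (X Y Z : Matrix (Fin n) (Fin d) ℝ) :
    ∃ r : ℕ, r ≤ (g + d).choose g ∧ ∃ U V W : Matrix (Fin n) (Fin r) ℝ, ∀ i j l : Fin n,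
      ∑ t, U i t * V j t * W l t =
        ∑ k ∈ Finset.range g, a k * (∑ m, X i m * Y j m * Z l m) ^ k := by
  let e := (Fintype.equivFin (Σ k : Fin g, Sym (Fin d) k)).symm
  refine ⟨_, card_sigma_sym_le d g,
    fun i t => a (e t).1 * (((e t).2 : Multiset (Fin d)).countPerms : ℝ) *
      (((e t).2 : Multiset (Fin d)).map (X i)).prod,
    fun j t => (((e t).2 : Multiset (Fin d)).map (Y j)).prod,
    fun l t => (((e t).2 : Multiset (Fin d)).map (Z l)).prod, fun i j l => ?_⟩
  rw [e.sum_comp (fun p : (Σ k : Fin g, Sym (Fin d) k) =>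
    a p.1 * ((p.2 : Multiset (Fin d)).countPerms : ℝ) *
      ((p.2 : Multiset (Fin d)).map (X i)).prod * ((p.2 : Multiset (Fin d)).map (Y j)).prod *
      ((p.2 : Multiset (Fin d)).map (Z l)).prod), Fintype.sum_sigma,
    ← Fin.sum_univ_eq_sum_range (fun k => a k * (∑ m, X i m * Y j m * Z l m) ^ k) g]
  refine Finset.sum_congr rfl fun k _ => ?_
  rw [Finset.sum_pow, Finset.sym_univ, Finset.mul_sum]
  refine Finset.sum_congr rfl fun s _ => ?_
  rw [Multiset.prod_map_mul, Multiset.prod_map_mul]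
  simp only [← mul_assoc]
  rfl

lemma abs_exp_sub_sum_range_le {x : ℝ} {g : ℕ} (h : |x| / (g + 1) ≤ 1 / 2) :
    |Real.exp x - ∑ k ∈ Finset.range g, x ^ k / k.factorial| ≤ |x| ^ g / g.factorial * 2 := by
  have := Complex.exp_bound' (x := (x : ℂ)) (n := g) (by simpa using h)
  rw [Complex.norm_real, Real.norm_eq_abs] at this
  rw [← Real.norm_eq_abs, ← Complex.norm_real]
  push_cast
  exact this

lemma pow_div_factorial_le_exp_mul {M : ℝ} (hM : 0 < M) {g : ℕ} (hg : 0 < g) :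
    M ^ g / g.factorial ≤ Real.exp (-(g * (Real.log (g / M) - 1))) := by
  have hg' : (0 : ℝ) < g := Nat.cast_pos.2 hg
  calc M ^ g / g.factorial = (M / g) ^ g * ((g : ℝ) ^ g / g.factorial) := by
        rw [div_pow]
        field_simp
    _ ≤ (M / g) ^ g * Real.exp g := by
        gcongr
        exact Real.pow_div_factorial_le_exp _ hg'.le _
    _ = Real.exp (-(g * (Real.log (g / M) - 1))) := by
        rw [← Real.exp_log (div_pos hM hg'), ← Real.exp_nat_mul, ← Real.exp_add,
          Real.log_div hM.ne' hg'.ne', Real.log_div hg'.ne' hM.ne']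
        ring_nf

lemma sqrt_two_add_le_max {y : ℝ} (hy : 0 ≤ y) :
    √(2 + y) ≤ 4 * max (y / Real.log (2 + y)) 1 := by
  have hs : (0 : ℝ) < √(2 + y) := Real.sqrt_pos.2 (by linarith)
  have hsq : √(2 + y) ^ 2 = 2 + y := Real.sq_sqrt (by linarith)
  have hlog : 0 < Real.log (2 + y) := Real.log_pos (by linarith)
  rcases le_total y 2 with h | h
  · have := le_max_right (y / Real.log (2 + y)) 1
    nlinarith
  · have h1 : Real.log (2 + y) ≤ 2 * √(2 + y) := by
      rw [← hsq, Real.log_pow]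
      have := Real.log_le_sub_one_of_pos hs
      push_cast
      rw [hsq]
      linarith
    have h2 : √(2 + y) / 4 ≤ y / Real.log (2 + y) := by
      rw [div_le_div_iff₀ (by norm_num) hlog]
      nlinarith
    have := le_max_left (y / Real.log (2 + y)) 1
    linarith

/-- The exponent `g * (log (g / M) - 1)` exceeds `L + 2 * M` once `g` is a sufficiently large
multiple of `max (L / log (2 + L / M)) M`. -/
lemma add_two_mul_le_mul_log {L M x : ℝ} (hL : 0 ≤ L) (hM : 0 < M)
    (hx : 16 * max (L / Real.log (2 + L / M)) M ≤ x) :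
    L + 2 * M ≤ x * (Real.log (x / M) - 1) := by
  have hy : 0 ≤ L / M := by positivity
  have hlog : 0 < Real.log (2 + L / M) := Real.log_pos (by linarith)
  have hxM : 16 * M ≤ x := by
    have := le_max_right (L / Real.log (2 + L / M)) M
    linarith
  have hxL : 16 * L ≤ x * Real.log (2 + L / M) := by
    have := le_max_left (L / Real.log (2 + L / M)) M
    have : 16 * (L / Real.log (2 + L / M)) ≤ x := by linarith
    rwa [← mul_div_assoc, div_le_iff₀ hlog] at this
  have hs : 0 < √(2 + L / M) := Real.sqrt_pos.2 (by linarith)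
  have hmax : M * max (L / M / Real.log (2 + L / M)) 1 =
      max (L / Real.log (2 + L / M)) M := by
    rw [mul_max_of_nonneg _ _ hM.le, mul_one]
    congr 1
    field_simp
  have hratio : 2 ^ 2 * √(2 + L / M) ≤ x / M := by
    rw [le_div_iff₀ hM]
    have := mul_le_mul_of_nonneg_left (sqrt_two_add_le_max hy) hM.le
    nlinarith
  have h := Real.log_le_log (by positivity) hratio
  rw [Real.log_mul (by norm_num) hs.ne', Real.log_sqrt (by linarith), Real.log_pow] at h
  push_cast at h
  have hb : 1 / 8 + Real.log (2 + L / M) / 2 ≤ Real.log (x / M) - 1 := by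
    have := Real.log_two_gt_d9
    linarith
  have := mul_le_mul_of_nonneg_left hb (by linarith : 0 ≤ x)
  nlinarith

lemma abs_sum_mul_mul_div_le {d : ℕ} {B : ℝ} (hd : 0 < d) (hB : 0 ≤ B) {u v w : Fin d → ℝ}
    (hu : ∀ m, |u m| ≤ B) (hv : ∀ m, |v m| ≤ B) (hw : ∀ m, |w m| ≤ B) :
    |(∑ m, u m * v m * w m) / d| ≤ B ^ 3 := by
  rw [abs_div, Nat.abs_cast, div_le_iff₀ (Nat.cast_pos.2 hd)]
  calc |∑ m, u m * v m * w m| ≤ ∑ m, |u m * v m * w m| := Finset.abs_sum_le_sum_abs _ _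
    _ ≤ ∑ _m : Fin d, B ^ 3 := by
        refine Finset.sum_le_sum fun m _ => ?_
        rw [abs_mul, abs_mul, pow_three']
        gcongr
        exacts [hu m, hv m, hw m]
    _ = B ^ 3 * d := by simp [mul_comm]

lemma abs_sum_range_sub_exp_le_mul_exp {M ε x : ℝ} {g : ℕ} (hM : 1 ≤ M) (hε : 0 < ε)
    (hε' : ε ≤ 1) (hx : |x| ≤ M)
    (hg : 16 * max (Real.log (1 / ε) / Real.log (2 + Real.log (1 / ε) / M)) M ≤ g) :
    |∑ k ∈ Finset.range g, x ^ k / k.factorial - Real.exp x| ≤ ε * Real.exp x := by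
  have hL : 0 ≤ Real.log (1 / ε) := Real.log_nonneg (by rwa [le_div_iff₀ hε, one_mul])
  have hgM : 16 * M ≤ g := by
    have := le_max_right (Real.log (1 / ε) / Real.log (2 + Real.log (1 / ε) / M)) M
    linarith
  have hg0 : 0 < g := Nat.cast_pos.1 (by linarith : (0 : ℝ) < g)
  have hexp := add_two_mul_le_mul_log hL (by linarith) hg
  rw [one_div, Real.log_inv] at hexp
  rw [abs_sub_comm]
  calc |Real.exp x - ∑ k ∈ Finset.range g, x ^ k / k.factorial|
      ≤ |x| ^ g / g.factorial * 2 := abs_exp_sub_sum_range_le (by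
        rw [div_le_div_iff₀ (by positivity) two_pos]
        linarith)
    _ ≤ M ^ g / g.factorial * 2 := by gcongr
    _ ≤ Real.exp (Real.log ε - 2 * M) * Real.exp M := by
        gcongr
        · exact (pow_div_factorial_le_exp_mul (by linarith) hg0).trans
            (Real.exp_le_exp.2 (by linarith))
        · linarith [Real.add_one_le_exp M]
    _ = ε * Real.exp (-M) := by
        rw [← Real.exp_add, ← Real.exp_log hε, ← Real.exp_add, Real.log_exp]
        ring_nf
    _ ≤ ε * Real.exp x := by
        gcongr
        exact neg_le_of_abs_le hx

/-- Low-rank relative approximation of the attention tensor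
`A_{i,j,l} = exp((Q ⊙ K₁ ⊙ K₂)_{i,j,l}/d)`: there is an absolute constant `c > 0` such that
for all `B > 1`, `ε ∈ (0,0.1)`, and bounded matrices `Q, K₁, K₂`, there exist
`g ≤ c·max{log(1/ε)/log(2 + log(1/ε)/B³), B³}`, `r ≤ C(3(g+d), 3g)`, and matrices
`U₁, U₂, U₃ ∈ ℝ^{n×r}` with `|Ã_{i,j,l} − A_{i,j,l}| ≤ ε·A_{i,j,l}` entrywise,
where `Ã = U₁ ⊙ U₂ ⊙ U₃`. -/
theorem attention_tensor_low_rank_approx :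
    ∃ c : ℝ, 0 < c ∧
      ∀ (n d : ℕ) (B ε : ℝ), 0 < d → 1 < B → 0 < ε → ε < 0.1 →
        ∀ Q K₁ K₂ : Matrix (Fin n) (Fin d) ℝ,
          (∀ i ℓ, |Q i ℓ| ≤ B) → (∀ i ℓ, |K₁ i ℓ| ≤ B) → (∀ i ℓ, |K₂ i ℓ| ≤ B) →
          ∃ g r : ℕ,
            (g : ℝ)
              ≤ c * max (Real.log (1 / ε) / Real.log (2 + Real.log (1 / ε) / B ^ 3)) (B ^ 3) ∧
            r ≤ Nat.choose (3 * (g + d)) (3 * g) ∧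
            ∃ U₁ U₂ U₃ : Matrix (Fin n) (Fin r) ℝ,
              ∀ i j l : Fin n,
                |(∑ t, U₁ i t * U₂ j t * U₃ l t)
                    - Real.exp ((∑ ℓ, Q i ℓ * K₁ j ℓ * K₂ l ℓ) / d)|
                  ≤ ε * Real.exp ((∑ ℓ, Q i ℓ * K₁ j ℓ * K₂ l ℓ) / d) := by
  refine ⟨17, by norm_num, fun n d B ε hd hB hε hε' Q K₁ K₂ hQ hK₁ hK₂ => ?_⟩
  have hM : 1 ≤ B ^ 3 := one_le_pow₀ hB.le
  set T := max (Real.log (1 / ε) / Real.log (2 + Real.log (1 / ε) / B ^ 3)) (B ^ 3) with hT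
  have hT1 : 1 ≤ T := hM.trans (le_max_right _ _)
  obtain ⟨r, hr, U, V, W, hUVW⟩ := exists_tensor_factorization_polynomial ⌈16 * T⌉₊
    (fun k => 1 / (d : ℝ) ^ k / k.factorial) Q K₁ K₂
  refine ⟨⌈16 * T⌉₊, r, ?_, hr.trans ?_, U, V, W, fun i j l => ?_⟩
  · have := Nat.ceil_lt_add_one (by linarith : 0 ≤ 16 * T)
    linarith
  · rw [mul_add]
    exact choose_add_left_mono (by omega) (by omega)
  · have hsum : ∑ t, U i t * V j t * W l t = ∑ k ∈ Finset.range ⌈16 * T⌉₊,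
        ((∑ m, Q i m * K₁ j m * K₂ l m) / d) ^ k / k.factorial := by
      rw [hUVW]
      refine Finset.sum_congr rfl fun k _ => ?_
      rw [div_pow]
      ring
    rw [hsum]
    exact abs_sum_range_sub_exp_le_mul_exp hM hε (by norm_num at hε'; linarith)
      (abs_sum_mul_mul_div_le hd (by linarith) (hQ i) (hK₁ j) (hK₂ l)) (Nat.le_ceil _)
end

section
/- Let a₁,…,a_n, b₁,…,b_n, c₁,…,c_n ∈ {0,1}^d, let β > 0 and set τ := exp(β/2). Define Q, K₁, K₂ ∈ ℝ^{2n×2d} as follows, writing each row as a pair of length-d blocks scaled by β^{1/3}: row i of Q is β^{1/3}(a_iᵀ, 𝟏_dᵀ) for i ∈ [n] and β^{1/3}(𝟎_dᵀ, 𝟏_dᵀ) for i ∈ [n+1,2n]; row j of K₁ is β^{1/3}(b_jᵀ, 𝟎_dᵀ) for j ∈ [n] and β^{1/3}(𝟎_dᵀ, 𝟏_dᵀ) for j ∈ [n+1,2n]; row j of K₂ is β^{1/3}(c_jᵀ, 𝟎_dᵀ) for j ∈ [n] and β^{1/3}(𝟎_dᵀ, 𝟏_dᵀ) for j ∈ [n+1,2n].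 Define A ∈ ℝ^{2n×(2n)²} by A_{i,(j₁,j₂)} = exp((Q (K₁ ⊘ K₂)ᵀ)_{i,(j₁,j₂)} / (2d)). Then for every i ∈ [2n], n²·τ ≤ Σ_{(j₁,j₂)∈[2n]×[2n]} A_{i,(j₁,j₂)} ≤ 4n²·τ. -/
open BigOperators Real

/-- Row-sum bounds for the attention matrix in the hardness reduction. With Boolean vectors
`a_i, b_j, c_j ∈ {0,1}^d`, `β > 0`, `τ := exp(β/2)`, and the block matrices
`Q, K₁, K₂ ∈ ℝ^{2n×2d}` of the reduction (rows indexed by `Fin n ⊕ Fin n`, columns by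
`Fin d ⊕ Fin d`, all entries scaled by `β^{1/3}`), the matrix
`A_{i,(j₁,j₂)} = exp((Q(K₁ ⊘ K₂)ᵀ)_{i,(j₁,j₂)}/(2d))` has all row sums in `[n²τ, 4n²τ]`. -/
theorem reduction_rowSum_bounds
    (n d : ℕ) (hn : 0 < n) (hd : 0 < d)
    (a b c : Fin n → Fin d → ℝ)
    (ha : ∀ i ℓ, a i ℓ = 0 ∨ a i ℓ = 1)
    (hb : ∀ i ℓ, b i ℓ = 0 ∨ b i ℓ = 1)
    (hc : ∀ i ℓ, c i ℓ = 0 ∨ c i ℓ = 1)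
    (β : ℝ) (hβ : 0 < β)
    (Q K₁ K₂ : Matrix (Fin n ⊕ Fin n) (Fin d ⊕ Fin d) ℝ)
    (hQ : ∀ p ℓ, Q p ℓ = β ^ ((1 : ℝ) / 3) *
      (match p, ℓ with
        | Sum.inl i, Sum.inl l => a i l
        | Sum.inl _, Sum.inr _ => 1
        | Sum.inr _, Sum.inl _ => 0
        | Sum.inr _, Sum.inr _ => 1))
    (hK₁ : ∀ p ℓ, K₁ p ℓ = β ^ ((1 : ℝ) / 3) *
      (match p, ℓ with
        | Sum.inl j, Sum.inl l => b j l
        | Sum.inl _, Sum.inr _ => 0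
        | Sum.inr _, Sum.inl _ => 0
        | Sum.inr _, Sum.inr _ => 1))
    (hK₂ : ∀ p ℓ, K₂ p ℓ = β ^ ((1 : ℝ) / 3) *
      (match p, ℓ with
        | Sum.inl j, Sum.inl l => c j l
        | Sum.inl _, Sum.inr _ => 0
        | Sum.inr _, Sum.inl _ => 0
        | Sum.inr _, Sum.inr _ => 1)) :
    ∀ i : Fin n ⊕ Fin n,
      (n : ℝ) ^ 2 * Real.exp (β / 2)
          ≤ ∑ j₁ : Fin n ⊕ Fin n, ∑ j₂ : Fin n ⊕ Fin n,
              Real.exp ((∑ ℓ, Q i ℓ * K₁ j₁ ℓ * K₂ j₂ ℓ) / (2 * d)) ∧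
        ∑ j₁ : Fin n ⊕ Fin n, ∑ j₂ : Fin n ⊕ Fin n,
              Real.exp ((∑ ℓ, Q i ℓ * K₁ j₁ ℓ * K₂ j₂ ℓ) / (2 * d))
          ≤ 4 * (n : ℝ) ^ 2 * Real.exp (β / 2) := by
  have hβ3 : (β ^ ((1 : ℝ) / 3)) ^ 3 = β := by
    rw [← Real.rpow_natCast, ← Real.rpow_mul hβ.le]
    norm_num
  have hd' : (0 : ℝ) < d := by exact_mod_cast hd
  generalize β ^ ((1 : ℝ) / 3) = s at hQ hK₁ hK₂ hβ3
  have hs : s * s * s = β := by rw [← hβ3]; ring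
  have hpeak (i : Fin n ⊕ Fin n) (j k : Fin n) :
      (∑ ℓ, Q i ℓ * K₁ (Sum.inr j) ℓ * K₂ (Sum.inr k) ℓ) / (2 * d) = β / 2 := by
    have hsum : ∑ ℓ, Q i ℓ * K₁ (Sum.inr j) ℓ * K₂ (Sum.inr k) ℓ = d * β := by
      rcases i with i | i <;> simp [Fintype.sum_sum_type, hQ, hK₁, hK₂, hs]
    rw [hsum]
    field_simp
  have hle (i j k : Fin n ⊕ Fin n) :
      (∑ ℓ, Q i ℓ * K₁ j ℓ * K₂ k ℓ) / (2 * d) ≤ β / 2 := by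
    have hzero : (0 : ℝ) / (2 * d) ≤ β / 2 := by rw [zero_div]; positivity
    rcases j with j | j <;> rcases k with k | k
    · have hsum : ∑ ℓ, Q i ℓ * K₁ (Sum.inl j) ℓ * K₂ (Sum.inl k) ℓ ≤ d * β := by
        have hterm (l : Fin d) :
            Q i (Sum.inl l) * K₁ (Sum.inl j) (Sum.inl l) * K₂ (Sum.inl k) (Sum.inl l) ≤ β := by
          rcases i with i | i
          · rcases ha i l with h₁ | h₁ <;> rcases hb j l with h₂ | h₂ <;>
              rcases hc k l with h₃ | h₃ <;> simp [hQ, hK₁, hK₂, h₁, h₂, h₃, hs, hβ.le]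
          · simp [hQ, hK₁, hK₂, hβ.le]
        rw [Fintype.sum_sum_type]
        have hinr (l : Fin d) : K₁ (Sum.inl j) (Sum.inr l) = 0 := by simp [hK₁]
        simpa [hinr] using Finset.sum_le_card_nsmul Finset.univ _ β fun l _ ↦ hterm l
      rw [div_le_div_iff₀ (by positivity) two_pos]
      linarith
    · simpa [Fintype.sum_sum_type, hK₁, hK₂] using hzero
    · simpa [Fintype.sum_sum_type, hK₁, hK₂] using hzero
    · exact (hpeak i j k).le
  intro i
  constructor
  · calc (n : ℝ) ^ 2 * Real.exp (β / 2)
        = ∑ j : Fin n, ∑ k : Fin n,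
            Real.exp ((∑ ℓ, Q i ℓ * K₁ (Sum.inr j) ℓ * K₂ (Sum.inr k) ℓ) / (2 * d)) := by
          simp only [hpeak, Finset.sum_const, Finset.card_univ, Fintype.card_fin, nsmul_eq_mul]
          ring
      _ ≤ _ := by
          rw [Fintype.sum_sum_type]
          refine le_add_of_nonneg_of_le (by positivity) (Finset.sum_le_sum fun j _ ↦ ?_)
          rw [Fintype.sum_sum_type]
          exact le_add_of_nonneg_left (by positivity)
  · calc _ ≤ ∑ _j : Fin n ⊕ Fin n, ∑ _k : Fin n ⊕ Fin n, Real.exp (β / 2) :=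
          Finset.sum_le_sum fun j _ ↦ Finset.sum_le_sum fun k _ ↦ Real.exp_le_exp.2 (hle i j k)
      _ = 4 * (n : ℝ) ^ 2 * Real.exp (β / 2) := by
          simp only [Finset.sum_const, Finset.card_univ, Fintype.card_sum, Fintype.card_fin,
            nsmul_eq_mul]
          push_cast
          ring
end

section
/- In the setting of the reduction construction: let a₁,…,a_n, b₁,…,b_n, c₁,…,c_n ∈ {0,1}^d, β > 0, τ := exp(β/2), and let A ∈ ℝ^{2n×(2n)²} be the matrix with A_{i,(j₁,j₂)} = exp(β⟨a_i, b_{j₁}, c_{j₂}⟩/(2d)) when i, j₁, j₂ ∈ [n], A_{i,(j₁,j₂)} = τ when both j₁ > n and j₂ > n, and A_{i,(j₁,j₂)} = 1 in all other cases. Let D := diag(A 𝟏_{(2n)²}), let v ∈ ℝ^{(2n)²} be the indicator vector of the pairs (j₁,j₂) with j₁ ≤ n and j₂ ≤ n, let t > 0, and set t̃ := exp(βt/(2d)) / (12 n² τ). If for some i ∈ [n] there exist j₁, j₂ ∈ [n] with ⟨a_i, b_{j₁}, c_{j₂}⟩ ≥ t, then (D^{-1} A v)_i ≥ 3 t̃.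 -/
open BigOperators Real

/-- The generalized inner product of three `{0,1}`-vectors is at most the dimension. -/
theorem triple_inner_le_card {ι : Type*} [Fintype ι] {x y z : ι → ℝ}
    (hx : ∀ l, x l = 0 ∨ x l = 1) (hy : ∀ l, y l = 0 ∨ y l = 1) (hz : ∀ l, z l = 0 ∨ z l = 1) :
    ∑ l, x l * y l * z l ≤ Fintype.card ι := by
  calc ∑ l, x l * y l * z l ≤ ∑ _l : ι, (1 : ℝ) := by
        refine Finset.sum_le_sum fun l _ => ?_
        rcases hx l with h | h <;> rcases hy l with h' | h' <;> rcases hz l with h'' | h'' <;>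
          simp [h, h', h'']
    _ = Fintype.card ι := by simp

/-- Case 1 of the reduction: in the construction with
`A_{i,(j₁,j₂)} = exp(β⟨a_i,b_{j₁},c_{j₂}⟩/(2d))` for `i,j₁,j₂ ∈ [n]`, `A = τ := exp(β/2)`
when both `j₁ > n` and `j₂ > n`, and `A = 1` otherwise; `D := diag(A 𝟏)`; `v` the indicator
of pairs with both coordinates in `[n]`; `t̃ := exp(βt/(2d))/(12n²τ)` — if some `i ∈ [n]` has
`⟨a_i,b_{j₁},c_{j₂}⟩ ≥ t` for some `j₁,j₂ ∈ [n]`, then `(D⁻¹Av)_i ≥ 3t̃`. -/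
theorem reduction_case_one
    (n d : ℕ) (hn : 0 < n) (hd : 0 < d)
    (a b c : Fin n → Fin d → ℝ)
    (ha : ∀ i ℓ, a i ℓ = 0 ∨ a i ℓ = 1)
    (hb : ∀ i ℓ, b i ℓ = 0 ∨ b i ℓ = 1)
    (hc : ∀ i ℓ, c i ℓ = 0 ∨ c i ℓ = 1)
    (β : ℝ) (hβ : 0 < β) (t : ℝ) (ht : 0 < t)
    (A : Matrix (Fin n ⊕ Fin n) ((Fin n ⊕ Fin n) × (Fin n ⊕ Fin n)) ℝ)
    (hA : ∀ i j₁ j₂, A i (j₁, j₂) =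
      (match i, j₁, j₂ with
        | Sum.inl i', Sum.inl j₁', Sum.inl j₂' =>
            Real.exp (β * (∑ ℓ, a i' ℓ * b j₁' ℓ * c j₂' ℓ) / (2 * d))
        | _, Sum.inr _, Sum.inr _ => Real.exp (β / 2)
        | _, _, _ => 1))
    (i : Fin n) (j₁ j₂ : Fin n)
    (hip : t ≤ ∑ ℓ, a i ℓ * b j₁ ℓ * c j₂ ℓ) :
    3 * (Real.exp (β * t / (2 * d)) / (12 * (n : ℝ) ^ 2 * Real.exp (β / 2)))
      ≤ (∑ p : (Fin n ⊕ Fin n) × (Fin n ⊕ Fin n),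
            A (Sum.inl i) p * (if p.1.isLeft && p.2.isLeft then (1 : ℝ) else 0))
          / (∑ p : (Fin n ⊕ Fin n) × (Fin n ⊕ Fin n), A (Sum.inl i) p) := by
  have hd' : (0 : ℝ) < d := by exact_mod_cast hd
  have hentry : ∀ p, 0 < A (Sum.inl i) p ∧ A (Sum.inl i) p ≤ Real.exp (β / 2) := by
    rintro ⟨k₁, k₂⟩
    rw [hA]
    rcases k₁ with k₁ | k₁ <;> rcases k₂ with k₂ | k₂
    · refine ⟨Real.exp_pos _, Real.exp_le_exp.mpr ?_⟩
      have hle := triple_inner_le_card (ha i) (hb k₁) (hc k₂)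
      rw [Fintype.card_fin] at hle
      rw [div_le_div_iff₀ (by positivity) two_pos]
      nlinarith [mul_le_mul_of_nonneg_left hle hβ.le]
    · exact ⟨one_pos, Real.one_le_exp (by positivity)⟩
    · exact ⟨one_pos, Real.one_le_exp (by positivity)⟩
    · exact ⟨Real.exp_pos _, le_rfl⟩
  have hrow_pos : 0 < ∑ p, A (Sum.inl i) p :=
    Finset.sum_pos (fun p _ => (hentry p).1) ⟨(Sum.inl j₁, Sum.inl j₂), Finset.mem_univ _⟩
  have hrow_le : ∑ p, A (Sum.inl i) p ≤ 4 * (n : ℝ) ^ 2 * Real.exp (β / 2) := by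
    calc ∑ p, A (Sum.inl i) p
        ≤ ∑ _p : (Fin n ⊕ Fin n) × (Fin n ⊕ Fin n), Real.exp (β / 2) :=
          Finset.sum_le_sum fun p _ => (hentry p).2
      _ = 4 * (n : ℝ) ^ 2 * Real.exp (β / 2) := by
          simp only [Finset.sum_const, Finset.card_univ, Fintype.card_prod, Fintype.card_sum,
            Fintype.card_fin, nsmul_eq_mul]
          push_cast
          ring
  have hnum : Real.exp (β * t / (2 * d)) ≤
      ∑ p : (Fin n ⊕ Fin n) × (Fin n ⊕ Fin n),
        A (Sum.inl i) p * (if p.1.isLeft && p.2.isLeft then (1 : ℝ) else 0) := by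
    calc Real.exp (β * t / (2 * d))
        ≤ A (Sum.inl i) (Sum.inl j₁, Sum.inl j₂) := by
          rw [hA]
          exact Real.exp_le_exp.mpr (by gcongr)
      _ = A (Sum.inl i) (Sum.inl j₁, Sum.inl j₂) *
            (if (Sum.inl j₁ : Fin n ⊕ Fin n).isLeft && (Sum.inl j₂ : Fin n ⊕ Fin n).isLeft
              then (1 : ℝ) else 0) := by simp
      _ ≤ _ := Finset.single_le_sum
          (f := fun p : (Fin n ⊕ Fin n) × (Fin n ⊕ Fin n) =>
            A (Sum.inl i) p * (if p.1.isLeft && p.2.isLeft then (1 : ℝ) else 0))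
          (fun p _ => mul_nonneg (hentry p).1.le (by split_ifs <;> norm_num))
          (Finset.mem_univ (Sum.inl j₁, Sum.inl j₂))
  calc 3 * (Real.exp (β * t / (2 * d)) / (12 * (n : ℝ) ^ 2 * Real.exp (β / 2)))
      = Real.exp (β * t / (2 * d)) / (4 * (n : ℝ) ^ 2 * Real.exp (β / 2)) := by
        field_simp
        norm_num
    _ ≤ _ := div_le_div₀ ((Real.exp_pos _).le.trans hnum) hnum hrow_pos hrow_le
end

section
/- In the setting of the reduction construction: let a₁,…,a_n, b₁,…,b_n, c₁,…,c_n ∈ {0,1}^d, β > 0, τ := exp(β/2), and let A ∈ ℝ^{2n×(2n)²} be the matrix with A_{i,(j₁,j₂)} = exp(β⟨a_i, b_{j₁}, c_{j₂}⟩/(2d)) when i, j₁, j₂ ∈ [n], A_{i,(j₁,j₂)} = τ when both j₁ > n and j₂ > n, and A_{i,(j₁,j₂)} = 1 in all other cases. Let D := diag(A 𝟏_{(2n)²}), let v ∈ ℝ^{(2n)²} be the indicator vector of the pairs (j₁,j₂) with j₁ ≤ n and j₂ ≤ n, let t > 0, ε ∈ (0,1), and set t̃ := exp(βt/(2d)) /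 (12 n² τ). Suppose exp(βεt/(2d)) ≥ 16 n². If for some i ∈ [n] we have ⟨a_i, b_{j₁}, c_{j₂}⟩ ≤ (1−ε)·t for all j₁, j₂ ∈ [n], then (D^{-1} A v)_i ≤ (3/4)·t̃. -/
open BigOperators Real

/-- Case 2 of the reduction: in the construction with
`A_{i,(j₁,j₂)} = exp(β⟨a_i,b_{j₁},c_{j₂}⟩/(2d))` for `i,j₁,j₂ ∈ [n]`, `A = τ := exp(β/2)`
when both `j₁ > n` and `j₂ > n`, and `A = 1` otherwise; `D := diag(A 𝟏)`; `v` the indicator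
of pairs with both coordinates in `[n]`; `t̃ := exp(βt/(2d))/(12n²τ)` — if
`exp(βεt/(2d)) ≥ 16n²` and some `i ∈ [n]` has `⟨a_i,b_{j₁},c_{j₂}⟩ ≤ (1−ε)t` for all
`j₁,j₂ ∈ [n]`, then `(D⁻¹Av)_i ≤ (3/4)t̃`. -/
theorem reduction_case_two
    (n d : ℕ) (hn : 0 < n) (hd : 0 < d)
    (a b c : Fin n → Fin d → ℝ)
    (ha : ∀ i ℓ, a i ℓ = 0 ∨ a i ℓ = 1)
    (hb : ∀ i ℓ, b i ℓ = 0 ∨ b i ℓ = 1)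
    (hc : ∀ i ℓ, c i ℓ = 0 ∨ c i ℓ = 1)
    (β : ℝ) (hβ : 0 < β) (t : ℝ) (ht : 0 < t) (ε : ℝ) (hε : 0 < ε) (hε' : ε < 1)
    (A : Matrix (Fin n ⊕ Fin n) ((Fin n ⊕ Fin n) × (Fin n ⊕ Fin n)) ℝ)
    (hA : ∀ i j₁ j₂, A i (j₁, j₂) =
      (match i, j₁, j₂ with
        | Sum.inl i', Sum.inl j₁', Sum.inl j₂' =>
            Real.exp (β * (∑ ℓ, a i' ℓ * b j₁' ℓ * c j₂' ℓ) / (2 * d))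
        | _, Sum.inr _, Sum.inr _ => Real.exp (β / 2)
        | _, _, _ => 1))
    (hgap : 16 * (n : ℝ) ^ 2 ≤ Real.exp (β * ε * t / (2 * d)))
    (i : Fin n)
    (hip : ∀ j₁ j₂ : Fin n, (∑ ℓ, a i ℓ * b j₁ ℓ * c j₂ ℓ) ≤ (1 - ε) * t) :
    (∑ p : (Fin n ⊕ Fin n) × (Fin n ⊕ Fin n),
          A (Sum.inl i) p * (if p.1.isLeft && p.2.isLeft then (1 : ℝ) else 0))
        / (∑ p : (Fin n ⊕ Fin n) × (Fin n ⊕ Fin n), A (Sum.inl i) p)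
      ≤ (3 / 4) * (Real.exp (β * t / (2 * d)) / (12 * (n : ℝ) ^ 2 * Real.exp (β / 2))) := by
  have hA_ll (j₁ j₂ : Fin n) : A (Sum.inl i) (Sum.inl j₁, Sum.inl j₂) =
      Real.exp (β * (∑ ℓ, a i ℓ * b j₁ ℓ * c j₂ ℓ) / (2 * d)) := hA _ _ _
  have hA_lr (j₁ j₂ : Fin n) : A (Sum.inl i) (Sum.inl j₁, Sum.inr j₂) = 1 := hA _ _ _
  have hA_rl (j₁ j₂ : Fin n) : A (Sum.inl i) (Sum.inr j₁, Sum.inl j₂) = 1 := hA _ _ _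
  have hA_rr (j₁ j₂ : Fin n) : A (Sum.inl i) (Sum.inr j₁, Sum.inr j₂) = Real.exp (β / 2) :=
    hA _ _ _
  have hn' : (0 : ℝ) < n := by exact_mod_cast hn
  have hτ : 0 < Real.exp (β / 2) := Real.exp_pos _
  have hden : (n : ℝ) ^ 2 * Real.exp (β / 2) ≤
      ∑ p : (Fin n ⊕ Fin n) × (Fin n ⊕ Fin n), A (Sum.inl i) p := by
    have hll : 0 ≤ ∑ j₁ : Fin n, ∑ j₂ : Fin n,
        Real.exp (β * (∑ ℓ, a i ℓ * b j₁ ℓ * c j₂ ℓ) / (2 * d)) := by positivity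
    simp only [Fintype.sum_prod_type, Fintype.sum_sum_type, hA_ll, hA_lr, hA_rl, hA_rr,
      Finset.sum_add_distrib, Finset.sum_const, Finset.card_univ, Fintype.card_fin, nsmul_eq_mul]
    nlinarith
  have hnum : (∑ p : (Fin n ⊕ Fin n) × (Fin n ⊕ Fin n),
      A (Sum.inl i) p * (if p.1.isLeft && p.2.isLeft then (1 : ℝ) else 0)) ≤
      Real.exp (β * t / (2 * d)) / 16 := by
    have hentry (j₁ j₂ : Fin n) : Real.exp (β * (∑ ℓ, a i ℓ * b j₁ ℓ * c j₂ ℓ) / (2 * d)) ≤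
        Real.exp (β * ((1 - ε) * t) / (2 * d)) := by
      gcongr
      exact hip j₁ j₂
    have hsum := Finset.sum_le_sum fun j₁ (_ : j₁ ∈ Finset.univ) =>
      Finset.sum_le_sum fun j₂ (_ : j₂ ∈ Finset.univ) => hentry j₁ j₂
    have hsplit : Real.exp (β * t / (2 * d)) =
        Real.exp (β * ε * t / (2 * d)) * Real.exp (β * ((1 - ε) * t) / (2 * d)) := by
      rw [← Real.exp_add]
      ring_nf
    have hmul := mul_le_mul_of_nonneg_right hgap
      (Real.exp_pos (β * ((1 - ε) * t) / (2 * d))).le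
    simp only [Finset.sum_const, Finset.card_univ, Fintype.card_fin, nsmul_eq_mul] at hsum
    simp only [Fintype.sum_prod_type, Fintype.sum_sum_type, hA_ll, Sum.isLeft_inl,
      Sum.isLeft_inr, Bool.and_true, Bool.and_false, Bool.false_eq_true, if_true, if_false,
      mul_one, mul_zero, Finset.sum_const_zero, add_zero]
    rw [hsplit]
    linarith
  calc _ ≤ (Real.exp (β * t / (2 * d)) / 16) / ((n : ℝ) ^ 2 * Real.exp (β / 2)) := by
        gcongr
    _ = _ := by
        field_simp
        norm_num
end
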